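/- Let D be an H-colored semicomplete digraph in which every 3-cycle is an H-cycle. If k ≥ 2, then D has a (k,H)-kernel. -/

import Mathlib

/-!
Setting: `A : V → V → Prop` is the arc relation of a loopless digraph `D`,
`AH : VH → VH → Prop` is the arc relation of a digraph `H` (possibly with loops),
and `ρ : V → V → VH` colors each arc of `D` with a vertex of `H`
(`D` is an `H`-colored digraph).
-/

open scoped Classical

noncomputable section

variable {V VH : Type*}

/-- `x 0, x 1, …, x n` is a walk of length `n` in the digraph with arc relation `A`. -/
def IsWalk (A : V → V → Prop) (n : ℕ) (x : ℕ → V) : Prop :=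
  ∀ i < n, A (x i) (x (i + 1))

/-- A (directed) path of length `n`: a walk whose `n + 1` vertices are pairwise distinct. -/
def IsPath (A : V → V → Prop) (n : ℕ) (x : ℕ → V) : Prop :=
  IsWalk A n x ∧ ∀ i ≤ n, ∀ j ≤ n, x i = x j → i = j

/-- A (directed) cycle of length `n`: a nontrivial closed walk whose first `n` vertices are
pairwise distinct. -/
def IsCycle (A : V → V → Prop) (n : ℕ) (x : ℕ → V) : Prop :=
  IsWalk A n x ∧ x n = x 0 ∧ 1 ≤ n ∧ ∀ i < n, ∀ j < n, x i = x j → i = j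

/-- The set `O_H(W)` of obstructions of an open walk `W = (x 0, …, x n)`: the indices
`i ∈ {1, …, n-1}` such that `(ρ(x_{i-1}, x_i), ρ(x_i, x_{i+1}))` is not an arc of `H`. -/
def obstrOpen (AH : VH → VH → Prop) (ρ : V → V → VH) (n : ℕ) (x : ℕ → V) : Finset ℕ :=
  (Finset.Ico 1 n).filter fun i => ¬ AH (ρ (x (i - 1)) (x i)) (ρ (x i) (x (i + 1)))

/-- The set `O_H(W)` of obstructions of a closed walk `W = (x 0, …, x n)` (`x n = x 0`):
the indices `i ∈ {0, …, n-1}`, taken modulo `n`, such that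
`(ρ(x_{i-1}, x_i), ρ(x_i, x_{i+1}))` is not an arc of `H`. -/
def obstrClosed (AH : VH → VH → Prop) (ρ : V → V → VH) (n : ℕ) (x : ℕ → V) : Finset ℕ :=
  (Finset.range n).filter fun i =>
    ¬ AH (ρ (x (if i = 0 then n - 1 else i - 1)) (x i)) (ρ (x i) (x (i + 1)))

/-- The `H`-length of an open walk: `|O_H(W)| + 1`. -/
def HLenOpen (AH : VH → VH → Prop) (ρ : V → V → VH) (n : ℕ) (x : ℕ → V) : ℕ :=
  (obstrOpen AH ρ n x).card + 1

/-- The `H`-length of a closed walk: `|O_H(W)|`. -/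
def HLenClosed (AH : VH → VH → Prop) (ρ : V → V → VH) (n : ℕ) (x : ℕ → V) : ℕ :=
  (obstrClosed AH ρ n x).card

/-- `(u,v)` is an arc of the `(l,H)`-closure `C_H^l(D)` iff there exists a `uv`-path in `D`
with `H`-length at most `l`. -/
def ClosureAdj (A : V → V → Prop) (AH : VH → VH → Prop) (ρ : V → V → VH) (l : ℕ)
    (u v : V) : Prop :=
  ∃ n x, 1 ≤ n ∧ IsPath A n x ∧ x 0 = u ∧ x n = v ∧ HLenOpen AH ρ n x ≤ l

/-- `S` is `(k,H)`-independent: every path between two different vertices of `S`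
has `H`-length at least `k`. -/
def KHIndependent (A : V → V → Prop) (AH : VH → VH → Prop) (ρ : V → V → VH)
    (k : ℕ) (S : Set V) : Prop :=
  ∀ u ∈ S, ∀ v ∈ S, u ≠ v →
    ∀ n x, IsPath A n x → x 0 = u → x n = v → k ≤ HLenOpen AH ρ n x

/-- `S` is `(l,H)`-absorbent: from every vertex outside `S` there exists a path to some
vertex of `S` with `H`-length at most `l`. -/
def LHAbsorbent (A : V → V → Prop) (AH : VH → VH → Prop) (ρ : V → V → VH)
    (l : ℕ) (S : Set V) : Prop :=
  ∀ v ∉ S, ∃ w ∈ S, ∃ n x, IsPath A n x ∧ x 0 = v ∧ x n = w ∧ HLenOpen AH ρ n x ≤ l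

/-- A `(k,H)`-kernel: a `(k,H)`-independent and `(k-1,H)`-absorbent set of vertices. -/
def IsKHKernel (A : V → V → Prop) (AH : VH → VH → Prop) (ρ : V → V → VH)
    (k : ℕ) (S : Set V) : Prop :=
  KHIndependent A AH ρ k S ∧ LHAbsorbent A AH ρ (k - 1) S

/-- A kernel of a digraph: an independent and absorbent set of vertices. -/
def IsKernel (A : V → V → Prop) (S : Set V) : Prop :=
  (∀ u ∈ S, ∀ v ∈ S, u ≠ v → ¬ A u v) ∧ ∀ u ∉ S, ∃ v ∈ S, A u v

/-- A digraph is semicomplete if every two different vertices are joined by at least one arc. -/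
def Semicomplete (A : V → V → Prop) : Prop :=
  ∀ u v : V, u ≠ v → A u v ∨ A v u

/-- An arc is a path of `H`-length `1`. -/
theorem exists_path_of_arc {A : V → V → Prop} (AH : VH → VH → Prop) (ρ : V → V → VH)
    {u v : V} (huv : u ≠ v) (h : A u v) :
    ∃ n x, IsPath A n x ∧ x 0 = u ∧ x n = v ∧ HLenOpen AH ρ n x ≤ 1 := by
  refine ⟨1, fun i => if i = 0 then u else v, ⟨?_, ?_⟩, by simp, by simp, by
    simp [HLenOpen, obstrOpen]⟩
  · intro i hi
    interval_cases i
    simpa using h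
  · intro i hi j hj
    interval_cases i <;> interval_cases j <;> simp [huv, huv.symm]

/-- If every `3`-cycle is an `H`-cycle, then two consecutive arcs of a `3`-cycle form a path of
`H`-length `1`. -/
theorem exists_path_of_triangle {A : V → V → Prop} (AH : VH → VH → Prop) (ρ : V → V → VH)
    (hHcyc : ∀ x : ℕ → V, IsCycle A 3 x → obstrClosed AH ρ 3 x = ∅)
    {u v w : V} (huv : u ≠ v) (hvw : v ≠ w) (hwu : w ≠ u)
    (h₁ : A u v) (h₂ : A v w) (h₃ : A w u) :
    ∃ n x, IsPath A n x ∧ x 0 = u ∧ x n = w ∧ HLenOpen AH ρ n x ≤ 1 := by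
  let x : ℕ → V := fun i => if i % 3 = 0 then u else if i % 3 = 1 then v else w
  have hdist : ∀ i < 3, ∀ j < 3, x i = x j → i = j := by
    intro i hi j hj
    interval_cases i <;> interval_cases j <;>
      simp [x, huv, huv.symm, hvw, hvw.symm, hwu, hwu.symm]
  have hwalk : IsWalk A 3 x := by
    intro i hi
    interval_cases i <;> simpa [x]
  have hobs := hHcyc x ⟨hwalk, by simp [x], by simp, hdist⟩
  refine ⟨2, x, ⟨fun i hi => hwalk i (by omega),
    fun i hi j hj => hdist i (by omega) j (by omega)⟩, by simp [x], by simp [x], ?_⟩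
  have hopen : obstrOpen AH ρ 2 x = ∅ := by
    rw [obstrOpen, Finset.filter_eq_empty_iff]
    rw [obstrClosed, Finset.filter_eq_empty_iff] at hobs
    intro i hi
    rw [Finset.mem_Ico] at hi
    obtain rfl : i = 1 := by omega
    simpa using hobs (x := 1) (by simp)
  simp [HLenOpen, hopen]

/-- Every `H`-colored semicomplete digraph in which every `3`-cycle is an `H`-cycle has a
`(k,H)`-kernel for every `k ≥ 2`. -/
theorem semicomplete_has_kHKernel_of_H_triangles [Fintype V]
    (A : V → V → Prop) (hloopless : ∀ v : V, ¬ A v v)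
    (hsemi : Semicomplete A)
    (AH : VH → VH → Prop) (ρ : V → V → VH)
    (hHcyc : ∀ x : ℕ → V, IsCycle A 3 x → obstrClosed AH ρ 3 x = ∅)
    (k : ℕ) (hk : 2 ≤ k) :
    ∃ S : Set V, IsKHKernel A AH ρ k S := by
  let P : V → V → Prop := fun u v =>
    ∃ n x, IsPath A n x ∧ x 0 = u ∧ x n = v ∧ HLenOpen AH ρ n x ≤ 1
  let R : V → V → Prop := fun u v => u ≠ v ∧ ¬ P v u
  have harc : ∀ u v, R u v → A u v ∧ ¬ A v u := fun u v h => by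
    have hvu : ¬ A v u := fun ha => h.2 (exists_path_of_arc AH ρ h.1.symm ha)
    exact ⟨(hsemi u v h.1).resolve_right hvu, hvu⟩
  have htrans : ∀ u v, Relation.TransGen R u v → A u v ∧ ¬ A v u := by
    intro u v h
    induction h with
    | single h => exact harc _ _ h
    | @tail v z _ hvz ih =>
      have hzu : z ≠ u := by
        rintro rfl
        exact ih.2 (harc _ _ hvz).1
      have huv : u ≠ v := by
        rintro rfl
        exact hloopless _ ih.1
      have hnot : ¬ A z u := fun ha =>
        hvz.2 (exists_path_of_triangle AH ρ hHcyc hzu huv hvz.1 ha ih.1 (harc _ _ hvz).1)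
      exact ⟨(hsemi z u hzu).resolve_left hnot, hnot⟩
  rcases isEmpty_or_nonempty V with hV | hV
  · exact ⟨∅, fun u => hV.elim u, fun u => hV.elim u⟩
  let T : V → V → Prop := fun a b => Relation.TransGen R b a
  have : IsTrans V T := ⟨fun _ _ _ hab hbc => Relation.TransGen.trans hbc hab⟩
  have : Std.Irrefl T := ⟨fun a h => hloopless a (htrans a a h).1⟩
  obtain ⟨m, -, hm⟩ :=
    (Finite.wellFounded_of_trans_of_irrefl T).has_min Set.univ Set.univ_nonempty
  refine ⟨{m}, fun u hu v hv huv => absurd (hu.trans hv.symm) huv, fun v hv => ?_⟩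
  have hP : P v m := by
    by_contra hP
    exact hm v trivial (Relation.TransGen.single ⟨fun h => hv h.symm, hP⟩)
  obtain ⟨n, x, hx, h0, hn, hlen⟩ := hP
  exact ⟨m, rfl, n, x, hx, h0, hn, by omega⟩
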